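/- Let I₁,...,I_s be ideals in ℂ[x₁,...,xₙ] each generated by linear forms, and let a₁,...,a_s be positive integers. If I₁^{a₁} ∩ ... ∩ I_s^{a_s} is not contained in I₁^{a₁+1}, then there exists a polynomial f ∈ I₁^{a₁} ∩ ... ∩ I_s^{a_s} with f ∉ I₁^{a₁+1} and deg f ≤ a₁ + ... + a_s. -/

import Mathlib

open MvPolynomial

section LinearForms

variable {σ K : Type*} [Field K]

/-- The substitution `xᵢ ↦ e (xᵢ - p xᵢ) + p xᵢ * T`. When `p` projects the linear forms onto a
subspace `W`, it records the degree along `W` and applies `e` to the complementary directions. -/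
noncomputable def gradedSubst (p : MvPolynomial σ K →ₗ[K] MvPolynomial σ K)
    (e : MvPolynomial σ K →ₐ[K] MvPolynomial σ K) :
    MvPolynomial σ K →ₐ[K] Polynomial (MvPolynomial σ K) :=
  aeval fun i => Polynomial.C (e (X i - p (X i))) + Polynomial.C (p (X i)) * Polynomial.X

/-- The substitution of the constants `v i` for the variables, as an endomorphism. -/
noncomputable def constSubst (v : σ → K) : MvPolynomial σ K →ₐ[K] MvPolynomial σ K :=
  aeval fun i => C (v i)

theorem constSubst_apply (v : σ → K) (f : MvPolynomial σ K) :
    constSubst v f = C (eval v f) := by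
  induction f using MvPolynomial.induction_on <;> simp_all [constSubst, algebraMap_eq]

variable {p : MvPolynomial σ K →ₗ[K] MvPolynomial σ K}
  {e : MvPolynomial σ K →ₐ[K] MvPolynomial σ K} {I : Ideal (MvPolynomial σ K)}

theorem gradedSubst_linear {l : MvPolynomial σ K} (hl : l.IsHomogeneous 1) :
    gradedSubst p e l = Polynomial.C (e (l - p l)) + Polynomial.C (p l) * Polynomial.X := by
  rw [← mem_homogeneousSubmodule, homogeneousSubmodule_one_eq_span_X] at hl
  induction hl using Submodule.span_induction with
  | mem x hx => obtain ⟨i, rfl⟩ := hx; simp [gradedSubst]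
  | zero => simp
  | add x y _ _ hx hy =>
    rw [map_add, hx, hy]
    simp only [map_sub, map_add]
    ring
  | smul c x _ hx =>
    rw [map_smul, hx]
    simp only [map_smul, ← smul_sub, ← Polynomial.smul_C, smul_add, smul_mul_assoc]

theorem coeff_gradedSubst_mem_pow {S : Set (MvPolynomial σ K)} (hS : ∀ l ∈ S, l.IsHomogeneous 1)
    (hp : ∀ l ∈ S, p l = l) {b : ℕ} {f : MvPolynomial σ K} (hf : f ∈ Ideal.span S ^ b) (k : ℕ) :
    (gradedSubst p e f).coeff k ∈ Ideal.span S ^ b := by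
  have hmap : (Ideal.span S).map (gradedSubst p e) ≤ (Ideal.span S).map Polynomial.C := by
    rw [Ideal.map_span, Ideal.span_le]
    rintro _ ⟨l, hl, rfl⟩
    rw [gradedSubst_linear (hS l hl), hp l hl, sub_self, map_zero, map_zero, zero_add]
    exact Ideal.mul_mem_right _ _ (Ideal.mem_map_of_mem _ (Ideal.subset_span hl))
  have := Ideal.pow_right_mono hmap b (Ideal.map_pow (gradedSubst p e) (Ideal.span S) b ▸
    Ideal.mem_map_of_mem (gradedSubst p e) hf)
  rw [← Ideal.map_pow] at this
  exact Ideal.mem_map_C_iff.mp this k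

theorem X_pow_dvd_gradedSubst {S : Set (MvPolynomial σ K)} (hS : ∀ l ∈ S, l.IsHomogeneous 1)
    (hp : ∀ l ∈ S, p l = l) {b : ℕ} {f : MvPolynomial σ K} (hf : f ∈ Ideal.span S ^ b) :
    Polynomial.X ^ b ∣ gradedSubst p e f := by
  have hmap : (Ideal.span S).map (gradedSubst p e) ≤ Ideal.span {Polynomial.X} := by
    rw [Ideal.map_span, Ideal.span_le]
    rintro _ ⟨l, hl, rfl⟩
    rw [gradedSubst_linear (hS l hl), hp l hl, sub_self, map_zero, map_zero, zero_add]
    exact Ideal.mul_mem_left _ _ (Ideal.mem_span_singleton_self _)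
  have := Ideal.pow_right_mono hmap b (Ideal.map_pow (gradedSubst p e) (Ideal.span S) b ▸
    Ideal.mem_map_of_mem (gradedSubst p e) hf)
  rwa [Ideal.span_singleton_pow, Ideal.mem_span_singleton] at this

theorem gradedSubst_id_mem_reesAlgebra (hpI : ∀ x, p x ∈ I) (f : MvPolynomial σ K) :
    gradedSubst p (AlgHom.id K _) f ∈ reesAlgebra I := by
  have hC (g : MvPolynomial σ K) : Polynomial.C g ∈ reesAlgebra I :=
    (reesAlgebra I).algebraMap_mem g
  induction f using MvPolynomial.induction_on with
  | C c => simpa [gradedSubst] using hC (C c)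
  | add f g hf hg => rw [map_add]; exact add_mem hf hg
  | mul_X f i hf =>
    rw [map_mul, gradedSubst_linear (isHomogeneous_X K i)]
    refine mul_mem hf (add_mem (hC _) ?_)
    rw [Polynomial.C_mul_X_eq_monomial]
    exact reesAlgebra.monomial_mem.mpr (by simpa using hpI _)

theorem eval_one_gradedSubst_id (f : MvPolynomial σ K) :
    (gradedSubst p (AlgHom.id K _) f).eval 1 = f := by
  induction f using MvPolynomial.induction_on with
  | C c => simp [gradedSubst, Polynomial.algebraMap_apply, algebraMap_eq]
  | add f g hf hg => rw [map_add, Polynomial.eval_add, hf, hg]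
  | mul_X f i hf =>
    rw [map_mul, Polynomial.eval_mul, hf, gradedSubst_linear (isHomogeneous_X K i)]
    simp

theorem mem_pow_of_X_pow_dvd_gradedSubst (hpI : ∀ x, p x ∈ I) {b : ℕ} {f : MvPolynomial σ K}
    (hf : Polynomial.X ^ b ∣ gradedSubst p (AlgHom.id K _) f) : f ∈ I ^ b := by
  rw [← eval_one_gradedSubst_id (p := p) f, Polynomial.eval_eq_sum]
  refine Ideal.sum_mem _ fun k _ => ?_
  simp only [one_pow, mul_one]
  by_cases hk : k < b
  · rw [Polynomial.X_pow_dvd_iff.mp hf k hk]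
    exact zero_mem _
  · exact Ideal.pow_le_pow_right (not_lt.mp hk)
      ((mem_reesAlgebra_iff I _).mp (gradedSubst_id_mem_reesAlgebra hpI f) k)

theorem totalDegree_coeff_gradedSubst_le (hp : ∀ x, (p x).IsHomogeneous 1) (v : σ → K)
    (f : MvPolynomial σ K) (k : ℕ) :
    ((gradedSubst p (constSubst v) f).coeff k).totalDegree ≤ k := by
  induction f using MvPolynomial.induction_on generalizing k with
  | C c =>
    simp only [gradedSubst, algHom_C, Polynomial.algebraMap_apply, algebraMap_eq,
      Polynomial.coeff_C]
    split_ifs <;> simp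
  | add f g hf hg =>
    rw [map_add, Polynomial.coeff_add]
    exact (totalDegree_add _ _).trans (max_le (hf k) (hg k))
  | mul_X f i hf =>
    rw [map_mul, gradedSubst_linear (isHomogeneous_X K i), constSubst_apply, mul_add, ← mul_assoc,
      Polynomial.coeff_add, Polynomial.coeff_mul_C]
    refine (totalDegree_add _ _).trans (max_le ?_ ?_)
    · refine (totalDegree_mul _ _).trans ?_
      rw [totalDegree_C]
      exact hf k
    · cases k with
      | zero => simp
      | succ k =>
        rw [Polynomial.coeff_mul_X, Polynomial.coeff_mul_C]
        exact (totalDegree_mul _ _).trans (add_le_add (hf k) (hp _).totalDegree_le)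

theorem eval_coeff_gradedSubst_constSubst (v : σ → K) (f : MvPolynomial σ K) (k : ℕ) :
    eval v ((gradedSubst p (constSubst v) f).coeff k) =
      eval v ((gradedSubst p (AlgHom.id K _) f).coeff k) := by
  suffices h : (gradedSubst p (constSubst v) f).map (eval v) =
      (gradedSubst p (AlgHom.id K _) f).map (eval v) by
    simpa only [Polynomial.coeff_map] using congrArg (Polynomial.coeff · k) h
  induction f using MvPolynomial.induction_on with
  | C c => simp only [gradedSubst, algHom_C]
  | add f g hf hg => rw [map_add, map_add, Polynomial.map_add, Polynomial.map_add, hf, hg]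
  | mul_X f i hf =>
    rw [map_mul, map_mul, Polynomial.map_mul, Polynomial.map_mul, hf,
      gradedSubst_linear (isHomogeneous_X K i), gradedSubst_linear (isHomogeneous_X K i),
      constSubst_apply]
    simp only [Polynomial.map_add, Polynomial.map_mul, Polynomial.map_C, eval_C, AlgHom.id_apply]

theorem span_linearForms_le_idealOfVars {S : Set (MvPolynomial σ K)}
    (hS : ∀ l ∈ S, l.IsHomogeneous 1) : Ideal.span S ≤ idealOfVars σ K := by
  refine Ideal.span_le.mpr fun l hl => ?_
  have := hS l hl
  rw [← mem_homogeneousSubmodule, homogeneousSubmodule_one_eq_span_X] at this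
  exact Submodule.span_le_restrictScalars K (MvPolynomial σ K) _ this

theorem eq_zero_of_mem_idealOfVars_pow {d : ℕ} {g : MvPolynomial σ K}
    (hg : g ∈ idealOfVars σ K ^ (d + 1)) (hd : g.totalDegree ≤ d) : g = 0 := by
  rw [mem_pow_idealOfVars_iff] at hg
  rw [← support_eq_empty, Finset.eq_empty_iff_forall_notMem]
  intro x hx
  have h1 := hg x hx
  have h2 := le_totalDegree hx
  rw [Finsupp.degree_apply] at h1
  rw [Finsupp.sum] at h2
  omega

/-- The linear forms in an ideal are the range of a linear projection. -/
theorem exists_projection_linearForms (I : Ideal (MvPolynomial σ K)) :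
    ∃ p : MvPolynomial σ K →ₗ[K] MvPolynomial σ K, (∀ x, p x ∈ I) ∧
      (∀ x, (p x).IsHomogeneous 1) ∧ ∀ l ∈ I, l.IsHomogeneous 1 → p l = l := by
  let W : Submodule K (MvPolynomial σ K) := I.restrictScalars K ⊓ homogeneousSubmodule σ K 1
  obtain ⟨g, hg⟩ := W.subtype.exists_leftInverse_of_injective W.ker_subtype
  refine ⟨W.subtype ∘ₗ g, fun x => (g x).2.1, fun x => (g x).2.2, fun l hl h1 => ?_⟩
  exact congrArg Subtype.val (LinearMap.congr_fun hg ⟨l, hl, h1⟩)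

end LinearForms

/-- Saito's degree-bound lemma for intersections of powers of ideals
generated by linear forms in ℂ[x₁,...,xₙ]. -/
theorem stmt0 (n s : ℕ) (hs : 0 < s)
    (I : Fin s → Ideal (MvPolynomial (Fin n) ℂ))
    (hlin : ∀ i, ∃ S : Set (MvPolynomial (Fin n) ℂ),
      (∀ p ∈ S, p.IsHomogeneous 1) ∧ I i = Ideal.span S)
    (a : Fin s → ℕ) (ha : ∀ i, 0 < a i)
    (h : ¬ (⨅ i, I i ^ a i) ≤ I ⟨0, hs⟩ ^ (a ⟨0, hs⟩ + 1)) :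
    ∃ f ∈ ⨅ i, I i ^ a i,
      f ∉ I ⟨0, hs⟩ ^ (a ⟨0, hs⟩ + 1) ∧ f.totalDegree ≤ ∑ i, a i := by
  classical
  generalize (⟨0, hs⟩ : Fin s) = o at h ⊢
  choose S hS hIS using hlin
  obtain ⟨f, hf, hfo⟩ := SetLike.not_le_iff_exists.mp h
  rw [Ideal.mem_iInf] at hf
  obtain ⟨p, hpI, hp1, hp⟩ := exists_projection_linearForms (I o)
  have hpS (j : Fin s) (hj : I j ≤ I o) : ∀ l ∈ S j, p l = l := fun l hl =>
    hp l (hj (hIS j ▸ Ideal.subset_span hl)) (hS j l hl)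
  have hdvd {b : ℕ} {q : MvPolynomial (Fin n) ℂ} (hq : q ∈ I o ^ b) :
      Polynomial.X ^ b ∣ gradedSubst p (AlgHom.id ℂ _) q :=
    X_pow_dvd_gradedSubst (hS o) (hpS o le_rfl) (hIS o ▸ hq)
  have hc : (gradedSubst p (AlgHom.id ℂ _) f).coeff (a o) ≠ 0 := fun hc =>
    hfo <| mem_pow_of_X_pow_dvd_gradedSubst hpI <| Polynomial.X_pow_dvd_iff.mpr fun k hk => by
      obtain hk | rfl := Nat.lt_succ_iff_lt_or_eq.mp hk
      · exact Polynomial.X_pow_dvd_iff.mp (hdvd (hf o)) k hk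
      · exact hc
  obtain ⟨v, hv⟩ : ∃ v, eval v ((gradedSubst p (AlgHom.id ℂ _) f).coeff (a o)) ≠ 0 := by
    by_contra! hv
    exact hc (MvPolynomial.funext fun v => by rw [hv v, map_zero])
  set g := (gradedSubst p (constSubst v) f).coeff (a o) with hg
  have hg0 : g ≠ 0 := by
    intro h0
    rw [← eval_coeff_gradedSubst_constSubst, ← hg, h0, map_zero] at hv
    exact hv rfl
  have hgdeg : g.totalDegree ≤ a o := totalDegree_coeff_gradedSubst_le hp1 v f _
  have hgo : g ∉ I o ^ (a o + 1) := fun hmem =>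
    hg0 <| eq_zero_of_mem_idealOfVars_pow (Ideal.pow_right_mono
      (hIS o ▸ span_linearForms_le_idealOfVars (hS o)) _ hmem) hgdeg
  have hgmem (j : Fin s) (hj : I j ≤ I o) : g ∈ I j ^ a j := by
    have := hf j
    rw [hIS j] at this ⊢
    exact coeff_gradedSubst_mem_pow (hS j) (hpS j hj) this _
  have hl (j : Fin s) : ∃ l, l.IsHomogeneous 1 ∧ l ∈ I j ∧ (¬ I j ≤ I o → l ∉ I o) := by
    by_cases hj : I j ≤ I o
    · exact ⟨0, isHomogeneous_zero _ _ _, zero_mem _, fun h => absurd hj h⟩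
    · obtain ⟨l, hlS, hlo⟩ : ∃ l ∈ S j, l ∉ I o := by
        by_contra! hall
        exact hj (hIS j ▸ Ideal.span_le.mpr hall)
      exact ⟨l, hS j l hlS, hIS j ▸ Ideal.subset_span hlS, fun _ => hlo⟩
  choose l hl1 hlmem hlo using hl
  set B : Finset (Fin s) := Finset.univ.filter fun j => ¬ I j ≤ I o with hB
  have hoB : o ∉ B := by simp [hB]
  refine ⟨g * ∏ j ∈ B, l j ^ a j, ?_, fun hmem => hgo ?_, ?_⟩
  · rw [Ideal.mem_iInf]
    intro j
    by_cases hj : I j ≤ I o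
    · exact Ideal.mul_mem_right _ _ (hgmem j hj)
    · have hjB : j ∈ B := by simp [hB, hj]
      exact Ideal.mul_mem_left _ _ (Ideal.mem_of_dvd _ (Finset.dvd_prod_of_mem _ hjB)
        (Ideal.pow_mem_pow (hlmem j) _))
  · have hmem' := hdvd hmem
    rw [map_mul] at hmem'
    refine mem_pow_of_X_pow_dvd_gradedSubst hpI
      (Polynomial.prime_X.pow_dvd_of_dvd_mul_right _ ?_ hmem')
    rw [map_prod, Polynomial.prime_X.dvd_finsetProd_iff]
    rintro ⟨j, hjB, hj⟩
    rw [map_pow] at hj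
    refine hlo j (Finset.mem_filter.mp hjB).2 ?_
    rw [← pow_one (I o)]
    exact mem_pow_of_X_pow_dvd_gradedSubst hpI
      (by simpa using Polynomial.prime_X.dvd_of_dvd_pow hj)
  · calc (g * ∏ j ∈ B, l j ^ a j).totalDegree
        ≤ a o + ∑ j ∈ B, a j := by
          refine (totalDegree_mul _ _).trans (add_le_add hgdeg ?_)
          refine (totalDegree_finsetProd _ _).trans (Finset.sum_le_sum fun j _ => ?_)
          simpa using ((hl1 j).pow (a j)).totalDegree_le
      _ = ∑ j ∈ insert o B, a j := (Finset.sum_insert hoB).symm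
      _ ≤ ∑ i, a i := Finset.sum_le_sum_of_subset (Finset.subset_univ _)
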